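/- Assume 𝒥 is independent and P ⊆ G satisfies the Toeplitz condition. Then the right G-action on (∂Σ)·G is minimal: for every ψ ∈ (∂Σ)·G, the orbit {ψ·g : g ∈ G} is dense in (∂Σ)·G. -/

import Mathlib

variable {G : Type*} [Group G]

/-- Left translate `g·X = {gx : x ∈ X}`. -/
def lmul (g : G) (X : Set G) : Set G := (g * ·) '' X

/-- `p⁻¹X = {y ∈ P : py ∈ X}`. -/
def presub (P : Submonoid G) (p : G) (X : Set G) : Set G := {y : G | y ∈ P ∧ p * y ∈ X}

/-- The constructible right ideals of `P`: the smallest family of subsets of `P`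
containing `∅` and `P` and closed under `X ↦ pX` and `X ↦ p⁻¹X` for `p ∈ P`. -/
inductive IsConstructible (P : Submonoid G) : Set G → Prop
  | empty : IsConstructible P ∅
  | base : IsConstructible P (P : Set G)
  | mul {p : G} (hp : p ∈ P) {X : Set G} (hX : IsConstructible P X) : IsConstructible P (lmul p X)
  | pre {p : G} (hp : p ∈ P) {X : Set G} (hX : IsConstructible P X) :
      IsConstructible P (presub P p X)

/-- `𝒥_P^G`: the smallest family of subsets of `G` containing `𝒥`, closed under left
translations by group elements and under finite intersections. -/
inductive IsConstructibleG (P : Submonoid G) : Set G → Prop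
  | base {X : Set G} (hX : IsConstructible P X) : IsConstructibleG P X
  | translate (g : G) {Y : Set G} (hY : IsConstructibleG P Y) : IsConstructibleG P (lmul g Y)
  | inter {Y₁ Y₂ : Set G} (h1 : IsConstructibleG P Y₁) (h2 : IsConstructibleG P Y₂) :
      IsConstructibleG P (Y₁ ∩ Y₂)

/-- A family of subsets (containing `∅` and closed under finite intersections) is
independent if whenever a member equals a finite union of members, it equals one of them. -/
def IsIndepFamily {α : Type*} (J : Set (Set α)) : Prop :=
  ∀ X ∈ J, ∀ n : ℕ, 0 < n → ∀ Xs : Fin n → Set α,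
    (∀ i, Xs i ∈ J) → X = ⋃ i, Xs i → ∃ i, X = Xs i

/-- The Toeplitz condition for `P ⊆ G` (set-theoretic form): for every `g ∈ G` with
`{x ∈ P : gx ∈ P} ≠ ∅` there are `p₁, q₁, …, pₙ, qₙ ∈ P` (`n ≥ 1`) with
`g = p₁⁻¹q₁⋯pₙ⁻¹qₙ` and `{x ∈ P : gx ∈ P} = qₙ⁻¹(pₙ(⋯(q₁⁻¹(p₁P))⋯))`. -/
def IsToeplitz (P : Submonoid G) : Prop :=
  ∀ g : G, {x : G | x ∈ P ∧ g * x ∈ P}.Nonempty →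
    ∃ l : List (G × G), l ≠ [] ∧ (∀ pq ∈ l, pq.1 ∈ P ∧ pq.2 ∈ P) ∧
      g = (l.map fun pq => pq.1⁻¹ * pq.2).prod ∧
      {x : G | x ∈ P ∧ g * x ∈ P} =
        l.foldl (fun S pq => presub P pq.2 (lmul pq.1 S)) (P : Set G)

/-- A `J`-valued filter. -/
def IsFilterOn {α : Type*} (J : Set (Set α)) (F : Set (Set α)) : Prop :=
  F ⊆ J ∧ (∀ X₁ ∈ F, ∀ X₂ ∈ J, X₁ ⊆ X₂ → X₂ ∈ F) ∧
    (∀ X₁ ∈ F, ∀ X₂ ∈ F, X₁ ∩ X₂ ∈ F) ∧ ∅ ∉ F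

open Classical in
/-- Indicator function of a family of sets, with values in the discrete space `Bool`;
this realizes a family as a point of the product space `{0,1}^(Set α)`. -/
noncomputable def chiF {α : Type*} (F : Set (Set α)) : Set α → Bool :=
  fun X => if X ∈ F then true else false

/-- `Σ`, the space of nonempty `𝒥`-valued filters, topologized as a subspace of
`{0,1}^𝒥` via indicator functions. -/
def SigmaT (P : Submonoid G) : Type _ :=
  {F : Set (Set G) // IsFilterOn {X : Set G | IsConstructible P X} F ∧ F.Nonempty}

noncomputable instance (P : Submonoid G) : TopologicalSpace (SigmaT P) :=
  TopologicalSpace.induced (fun F : SigmaT P => chiF F.1) inferInstance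

/-- `pℱ = {X ∈ 𝒥 : p⁻¹X ∈ ℱ}`. -/
def fwdF (P : Submonoid G) (p : G) (F : Set (Set G)) : Set (Set G) :=
  {X : Set G | IsConstructible P X ∧ presub P p X ∈ F}

/-- `p⁻¹𝒢 = {X ∈ 𝒥 : pX ∈ 𝒢}`. -/
def bwdF (P : Submonoid G) (p : G) (F : Set (Set G)) : Set (Set G) :=
  {X : Set G | IsConstructible P X ∧ lmul p X ∈ F}

/-- `ℱ` is a `𝒥`-valued ultrafilter: a maximal element of `Σ` w.r.t. inclusion. -/
def IsUltraFilterOn (P : Submonoid G) (F : Set (Set G)) : Prop :=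
  (IsFilterOn {X : Set G | IsConstructible P X} F ∧ F.Nonempty) ∧
    ∀ F' : Set (Set G), IsFilterOn {X : Set G | IsConstructible P X} F' → F'.Nonempty →
      F ⊆ F' → F' = F

/-- `Σ^G`, the space of nonempty `𝒥_P^G`-valued filters, topologized as a subspace of
`{0,1}^{𝒥_P^G}` via indicator functions. -/
def SigmaGT (P : Submonoid G) : Type _ :=
  {F : Set (Set G) // IsFilterOn {Y : Set G | IsConstructibleG P Y} F ∧ F.Nonempty}

noncomputable instance (P : Submonoid G) : TopologicalSpace (SigmaGT P) :=
  TopologicalSpace.induced (fun F : SigmaGT P => chiF F.1) inferInstance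

/-- The right `G`-action on `𝒥_P^G`-valued filters: `ℱ̂·g = {Y ∈ 𝒥_P^G : g·Y ∈ ℱ̂}`. -/
def actG (P : Submonoid G) (g : G) (F : Set (Set G)) : Set (Set G) :=
  {Y : Set G | IsConstructibleG P Y ∧ lmul g Y ∈ F}

/-- `ι(ℱ) = {Y ∈ 𝒥_P^G : Y ∩ P ∈ ℱ}`, embedding `𝒥`-valued filters into `𝒥_P^G`-valued
filters. -/
def iotaF (P : Submonoid G) (F : Set (Set G)) : Set (Set G) :=
  {Y : Set G | IsConstructibleG P Y ∧ (Y ∩ (P : Set G)) ∈ F}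

/-- The boundary space `(∂Σ)·G = {ι(ℱ)·g : ℱ ∈ ∂Σ, g ∈ G} ⊆ Σ^G`, where
`∂Σ = closure Σ_max`. -/
def bdOrbit (P : Submonoid G) : Set (SigmaGT P) :=
  {Fh : SigmaGT P | ∃ F : SigmaT P,
    F ∈ closure {E : SigmaT P | IsUltraFilterOn P E.1} ∧
      ∃ g : G, Fh.1 = actG P g (iotaF P F.1)}

/-- `G₀ = {g ∈ G : (g·P) ∩ X ≠ ∅ and (g⁻¹·P) ∩ X ≠ ∅ for all nonempty X ∈ 𝒥}`. -/
def Gzero (P : Submonoid G) : Set G :=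
  {g : G | ∀ X : Set G, IsConstructible P X → X.Nonempty →
    (lmul g (P : Set G) ∩ X).Nonempty ∧ (lmul g⁻¹ (P : Set G) ∩ X).Nonempty}

theorem mem_lmul_iff {g x : G} {X : Set G} : x ∈ lmul g X ↔ g⁻¹ * x ∈ X := by
  constructor
  · rintro ⟨y, hy, rfl⟩
    simpa using hy
  · intro h
    exact ⟨_, h, by simp⟩

theorem lmul_lmul (g h : G) (X : Set G) : lmul g (lmul h X) = lmul (g * h) X := by
  ext x
  simp [mem_lmul_iff, mul_assoc]

theorem lmul_inter (g : G) (X Y : Set G) : lmul g (X ∩ Y) = lmul g X ∩ lmul g Y := by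
  ext x
  simp [mem_lmul_iff]

theorem lmul_one (X : Set G) : lmul 1 X = X := by
  ext x
  simp [mem_lmul_iff]

theorem lmul_empty (g : G) : lmul g (∅ : Set G) = ∅ := by
  simp [lmul]

namespace IsConstructible

variable {P : Submonoid G} {X Y : Set G}

theorem subset (hX : IsConstructible P X) : X ⊆ P := by
  induction hX with
  | empty => exact Set.empty_subset _
  | base => exact subset_rfl
  | mul hp _ ih =>
    rintro _ ⟨y, hy, rfl⟩
    exact P.mul_mem hp (ih hy)
  | pre _ _ _ => exact fun y hy => hy.1

theorem mul_mem (hX : IsConstructible P X) : ∀ x ∈ X, ∀ y ∈ P, x * y ∈ X := by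
  induction hX with
  | empty => simp
  | base => exact fun x hx y hy => P.mul_mem hx hy
  | mul hp _ ih =>
    rintro _ ⟨x, hx, rfl⟩ y hy
    exact ⟨x * y, ih x hx y hy, by simp [mul_assoc]⟩
  | pre _ _ ih =>
    rintro x ⟨hx, hpx⟩ y hy
    exact ⟨P.mul_mem hx hy, by simpa [mul_assoc] using ih _ hpx y hy⟩

theorem inter (hX : IsConstructible P X) (hY : IsConstructible P Y) :
    IsConstructible P (X ∩ Y) := by
  induction hX generalizing Y with
  | empty => simpa using IsConstructible.empty
  | base => simpa [Set.inter_eq_self_of_subset_right hY.subset] using hY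
  | @mul p hp X hX ih =>
    have h : lmul p X ∩ Y = lmul p (X ∩ presub P p Y) := by
      ext x
      simp only [Set.mem_inter_iff, mem_lmul_iff, presub, Set.mem_ofPred_eq, mul_inv_cancel_left]
      exact ⟨fun h => ⟨h.1, hX.subset h.1, h.2⟩, fun h => ⟨h.1, h.2.2⟩⟩
    exact h ▸ (ih (hY.pre hp)).mul hp
  | @pre p hp X hX ih =>
    have h : presub P p X ∩ Y = presub P p (X ∩ lmul p Y) := by
      ext x
      simp only [Set.mem_inter_iff, mem_lmul_iff, presub, Set.mem_ofPred_eq, inv_mul_cancel_left]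
      exact ⟨fun h => ⟨h.1.1, h.1.2, h.2⟩, fun h => ⟨⟨h.1, h.2.1⟩, h.2.2⟩⟩
    exact h ▸ (ih (hY.mul hp)).pre hp

theorem foldl (hX : IsConstructible P X) (l : List (G × G))
    (hl : ∀ pq ∈ l, pq.1 ∈ P ∧ pq.2 ∈ P) :
    IsConstructible P (l.foldl (fun S pq => presub P pq.2 (lmul pq.1 S)) X) := by
  induction l generalizing X with
  | nil => exact hX
  | cons a l ih =>
    have ha := hl a (by simp)
    exact ih ((hX.mul ha.1).pre ha.2) fun b hb => hl b (by simp [hb])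

end IsConstructible

theorem foldl_presub_lmul (P : Submonoid G) {X : Set G} (hX : X ⊆ P) (l : List (G × G)) :
    l.foldl (fun S pq => presub P pq.2 (lmul pq.1 S)) X =
      {x | x ∈ l.foldl (fun S pq => presub P pq.2 (lmul pq.1 S)) (P : Set G) ∧
        (l.map fun pq => pq.1⁻¹ * pq.2).prod * x ∈ X} := by
  induction l using List.reverseRecOn with
  | nil =>
    ext x
    simpa using fun h => hX h
  | append_singleton l a ih =>
    ext x
    simp only [List.foldl_append, List.foldl_cons, List.foldl_nil, List.map_append, List.map_cons,
      List.map_nil, List.prod_append, List.prod_singleton]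
    rw [ih]
    simp only [presub, mem_lmul_iff, Set.mem_ofPred_eq, mul_assoc, and_assoc]

/-- Under the Toeplitz condition, translates of constructible ideals meet `P` in
constructible ideals. -/
theorem IsToeplitz.isConstructible_lmul_inter {P : Submonoid G} (hT : IsToeplitz P) (g : G)
    {X : Set G} (hX : IsConstructible P X) : IsConstructible P (lmul g X ∩ P) := by
  rcases (lmul g X ∩ P).eq_empty_or_nonempty with h | ⟨x, hx, hxP⟩
  · exact h ▸ IsConstructible.empty
  rw [mem_lmul_iff] at hx
  obtain ⟨l, -, hl, hprod, hdom⟩ := hT g⁻¹ ⟨x, hxP, hX.subset hx⟩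
  have h : lmul g X ∩ P = l.foldl (fun S pq => presub P pq.2 (lmul pq.1 S)) X := by
    rw [foldl_presub_lmul P hX.subset, ← hdom, ← hprod]
    ext y
    simp only [Set.mem_inter_iff, mem_lmul_iff, SetLike.mem_coe, Set.mem_ofPred_eq]
    exact ⟨fun h => ⟨⟨h.2, hX.subset h.1⟩, h.1⟩, fun h => ⟨h.2, h.1.1⟩⟩
  exact h ▸ hX.foldl l hl

theorem IsConstructibleG.isConstructible_lmul_inter {P : Submonoid G} (hT : IsToeplitz P)
    {Y : Set G} (hY : IsConstructibleG P Y) (g : G) : IsConstructible P (lmul g Y ∩ P) := by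
  induction hY generalizing g with
  | base hX => exact hT.isConstructible_lmul_inter g hX
  | translate h _ ih => exact lmul_lmul g h _ ▸ ih (g * h)
  | inter _ _ ih₁ ih₂ =>
    rw [lmul_inter, Set.inter_inter_distrib_right]
    exact (ih₁ g).inter (ih₂ g)

theorem isConstructibleG_lmul_iff {P : Submonoid G} {g : G} {Y : Set G} :
    IsConstructibleG P (lmul g Y) ↔ IsConstructibleG P Y :=
  ⟨fun h => by simpa [lmul_lmul, lmul_one] using h.translate g⁻¹, fun h => h.translate g⟩

theorem actG_actG (P : Submonoid G) (g h : G) (F : Set (Set G)) :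
    actG P h (actG P g F) = actG P (g * h) F := by
  ext Y
  simp only [actG, Set.mem_ofPred_eq, lmul_lmul, isConstructibleG_lmul_iff]
  tauto

theorem mem_actG_iotaF {P : Submonoid G} {g : G} {F : Set (Set G)} {Y : Set G} :
    Y ∈ actG P g (iotaF P F) ↔ IsConstructibleG P Y ∧ lmul g Y ∩ P ∈ F := by
  simp only [actG, iotaF, Set.mem_ofPred_eq, isConstructibleG_lmul_iff]
  tauto

theorem IsFilterOn.actG {P : Submonoid G} {F : Set (Set G)}
    (hF : IsFilterOn {Y : Set G | IsConstructibleG P Y} F) (g : G) :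
    IsFilterOn {Y : Set G | IsConstructibleG P Y} (actG P g F) := by
  obtain ⟨-, hup, hinter, hempty⟩ := hF
  refine ⟨fun Y hY => hY.1, fun X hX Y hY hXY => ⟨hY, ?_⟩, fun X hX Y hY => ⟨hX.1.inter hY.1, ?_⟩,
    fun h => hempty (lmul_empty g ▸ h.2)⟩
  · exact hup _ hX.2 _ (hY.translate g) (Set.image_mono hXY)
  · exact lmul_inter g X Y ▸ hinter _ hX.2 _ hY.2

theorem nonempty_actG {P : Submonoid G} {F : Set (Set G)}
    (hF : F ⊆ {Y : Set G | IsConstructibleG P Y}) (hne : F.Nonempty) (g : G) :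
    (actG P g F).Nonempty := by
  obtain ⟨Y, hY⟩ := hne
  exact ⟨lmul g⁻¹ Y, (hF hY).translate _, by simpa [lmul_lmul, lmul_one] using hY⟩

/-- An ultrafilter contains a set disjoint from any given constructible ideal outside it. -/
theorem IsUltraFilterOn.exists_disjoint {P : Submonoid G} {F : Set (Set G)}
    (hF : IsUltraFilterOn P F) {Z : Set G} (hZ : IsConstructible P Z) (hZF : Z ∉ F) :
    ∃ X ∈ F, X ∩ Z = ∅ := by
  by_contra! hne
  obtain ⟨⟨⟨hsub, -, hinter, -⟩, X₀, hX₀⟩, hmax⟩ := hF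
  refine hZF ?_
  rw [← hmax {Y | IsConstructible P Y ∧ ∃ X ∈ F, X ∩ Z ⊆ Y} ⟨fun Y hY => hY.1, ?_, ?_, ?_⟩ ?_ ?_]
  · exact ⟨hZ, X₀, hX₀, Set.inter_subset_right⟩
  · rintro Y₁ ⟨-, X, hX, hXY⟩ Y₂ hY₂ hY
    exact ⟨hY₂, X, hX, hXY.trans hY⟩
  · rintro Y₁ ⟨hY₁, X₁, hX₁, h₁⟩ Y₂ ⟨hY₂, X₂, hX₂, h₂⟩
    exact ⟨hY₁.inter hY₂, X₁ ∩ X₂, hinter _ hX₁ _ hX₂,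
      fun x hx => ⟨h₁ ⟨hx.1.1, hx.2⟩, h₂ ⟨hx.1.2, hx.2⟩⟩⟩
  · rintro ⟨-, X, hX, h⟩
    exact (hne X hX).ne_empty (Set.subset_empty_iff.1 h)
  · exact ⟨Z, hZ, X₀, hX₀, Set.inter_subset_right⟩
  · exact fun Y hY => ⟨hsub hY, Y, hY, Set.inter_subset_left⟩

/-- Membership of finitely many constructible ideals in an ultrafilter is decided by one of
its elements. -/
theorem IsUltraFilterOn.exists_forall_subset_or_disjoint {P : Submonoid G} {F : Set (Set G)}
    (hF : IsUltraFilterOn P F) (T : Finset (Set G)) :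
    ∃ X ∈ F, ∀ Z ∈ T, (Z ∈ F → X ⊆ Z) ∧ (IsConstructible P Z → Z ∉ F → X ∩ Z = ∅) := by
  classical
  induction T using Finset.induction_on with
  | empty =>
    obtain ⟨X, hX⟩ := hF.1.2
    exact ⟨X, hX, by simp⟩
  | insert Z T _ ih =>
    obtain ⟨X, hX, hXT⟩ := ih
    obtain ⟨X', hX', h₁, h₂⟩ :
        ∃ X' ∈ F, (Z ∈ F → X' ⊆ Z) ∧ (IsConstructible P Z → Z ∉ F → X' ∩ Z = ∅) := by
      by_cases hZF : Z ∈ F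
      · exact ⟨Z, hZF, fun _ => subset_rfl, fun _ h => absurd hZF h⟩
      · by_cases hZ : IsConstructible P Z
        · obtain ⟨X', hX', h⟩ := hF.exists_disjoint hZ hZF
          exact ⟨X', hX', fun h => absurd h hZF, fun _ _ => h⟩
        · exact ⟨X, hX, fun h => absurd h hZF, fun h => absurd h hZ⟩
    refine ⟨X ∩ X', hF.1.1.2.2.1 _ hX _ hX', fun W hW => ?_⟩
    rcases Finset.mem_insert.1 hW with rfl | hW
    · exact ⟨fun h => Set.inter_subset_right.trans (h₁ h), fun hc h => Set.subset_empty_iff.1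
        ((Set.inter_subset_inter_left _ Set.inter_subset_right).trans (h₂ hc h).subset)⟩
    · exact ⟨fun h => Set.inter_subset_left.trans ((hXT W hW).1 h), fun hc h =>
        Set.subset_empty_iff.1 ((Set.inter_subset_inter_left _ Set.inter_subset_left).trans
          ((hXT W hW).2 hc h).subset)⟩

theorem chiF_eq_chiF_iff {α : Type*} {F F' : Set (Set α)} {Y : Set α} :
    chiF F Y = chiF F' Y ↔ (Y ∈ F ↔ Y ∈ F') := by
  by_cases h : Y ∈ F <;> by_cases h' : Y ∈ F' <;> simp [chiF, h, h']

/-- Closures in a space of families of sets: agreement on finitely many sets at a time. -/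
theorem mem_closure_iff_of_isInducing_chiF {α β : Type*} [TopologicalSpace β]
    {f : β → Set (Set α)} (hf : Topology.IsInducing fun b => chiF (f b)) {S : Set β} {a : β} :
    a ∈ closure S ↔ ∀ T : Finset (Set α), ∃ s ∈ S, ∀ Y ∈ T, (Y ∈ f s ↔ Y ∈ f a) := by
  rw [hf.closure_eq_preimage_closure_image, Set.mem_preimage, mem_closure_iff_nhds]
  constructor
  · intro h T
    obtain ⟨_, hs, s, hsS, rfl⟩ := h (Set.pi T fun Y => {chiF (f a) Y})
      (set_pi_mem_nhds T.finite_toSet fun Y _ => by simp)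
    exact ⟨s, hsS, fun Y hY => chiF_eq_chiF_iff.1 (hs Y hY)⟩
  · intro h U hU
    rw [nhds_pi, Filter.mem_pi'] at hU
    obtain ⟨T, t, ht, hTU⟩ := hU
    obtain ⟨s, hsS, hs⟩ := h T
    refine ⟨_, hTU fun Y hY => ?_, s, hsS, rfl⟩
    change chiF (f s) Y ∈ t Y
    rw [chiF_eq_chiF_iff.2 (hs Y hY)]
    exact mem_of_mem_nhds (ht Y)

/-- Assume `𝒥` is independent and `P ⊆ G` is Toeplitz. Then the right `G`-action on
`(∂Σ)·G` is minimal: every orbit is dense. -/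
theorem stmt_16 (P : Submonoid G)
    (hind : IsIndepFamily {X : Set G | IsConstructible P X}) (hT : IsToeplitz P) :
    ∀ ψ : ↥(bdOrbit P),
      Dense {w : ↥(bdOrbit P) | ∃ g : G, w.1.1 = actG P g ψ.1.1} := by
  rintro ⟨ψ, E, hE, h, hψ⟩ ⟨w, F, hF, g, hw⟩
  classical
  rw [mem_closure_iff_of_isInducing_chiF (f := fun v : ↥(bdOrbit P) => v.1.1)
    ((Topology.IsInducing.induced fun v : SigmaGT P => chiF v.1).comp
      Topology.IsInducing.subtypeVal)]
  intro T
  obtain ⟨F', hF', hFF'⟩ := (mem_closure_iff_of_isInducing_chiF (f := fun v : SigmaT P => v.1)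
    (Topology.IsInducing.induced _)).1 hF (T.image fun Y => lmul g Y ∩ P)
  obtain ⟨X, hX, hXT⟩ :=
    IsUltraFilterOn.exists_forall_subset_or_disjoint hF' (T.image fun Y => lmul g Y ∩ P)
  have hXc : IsConstructible P X := F'.2.1.1 hX
  obtain ⟨p, hp⟩ : X.Nonempty :=
    Set.nonempty_iff_ne_empty.2 fun h => F'.2.1.2.2.2 (h ▸ hX)
  have hk : actG P (h⁻¹ * (p⁻¹ * g)) ψ.1 = actG P (p⁻¹ * g) (iotaF P E.1) := by
    rw [hψ, actG_actG, mul_inv_cancel_left]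
  refine ⟨⟨⟨actG P (h⁻¹ * (p⁻¹ * g)) ψ.1, ψ.2.1.actG _, nonempty_actG ψ.2.1.1 ψ.2.2 _⟩,
    E, hE, _, hk⟩, ⟨_, rfl⟩, fun Y hY => ?_⟩
  have hY' := Finset.mem_image_of_mem (fun Y => lmul g Y ∩ (P : Set G)) hY
  simp only [hk, hw, mem_actG_iotaF]
  refine and_congr_right fun hYc => ?_
  rw [← hFF' _ hY']
  have hZ : IsConstructible P (lmul g Y ∩ P) := hYc.isConstructible_lmul_inter hT g
  have hmem : ∀ y, y ∈ lmul (p⁻¹ * g) Y ↔ p * y ∈ lmul g Y := by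
    simp [mem_lmul_iff, mul_assoc]
  constructor
  · intro hYE
    by_contra hYF
    refine E.2.1.2.2.2 ?_
    convert hYE
    symm
    rw [Set.eq_empty_iff_forall_notMem]
    rintro y ⟨hy, hyP⟩
    have hpy := hXc.mul_mem p hp y hyP
    exact ((hXT _ hY').2 hZ hYF).subset ⟨hpy, (hmem y).1 hy, hXc.subset hpy⟩
  · intro hYF
    obtain ⟨W, hW⟩ := E.2.2
    have hPE : (P : Set G) ∈ E.1 :=
      E.2.1.2.1 W hW _ IsConstructible.base (E.2.1.1 hW : IsConstructible P W).subset
    convert hPE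
    exact Set.inter_eq_right.2 fun y hy =>
      (hmem y).2 ((hXT _ hY').1 hYF (hXc.mul_mem p hp y hy)).1
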